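/- (Gaussian noise mechanism for random projections, Theorem 4.) Let k ≥ 1, ε > 0, 0 < δ < 1/2, and w ≥ 0. Suppose σ ≥ w · √(2(ln(1/(2δ)) + ε)) / ε. Let m, m' ∈ ℝ^k with ‖m − m'‖₂ ≤ w, and let μ (respectively μ') be the product measure on ℝ^k whose j-th coordinate is a real Gaussian with mean m_j (respectively m'_j) and variance σ². Then for every Borel measurable set S ⊆ ℝ^k, μ(S) ≤ e^ε · μ'(S) + δ. -/

import Mathlib

open MeasureTheory ProbabilityTheory

lemma gm_density (a b : ℝ) {v : NNReal} (hv : v ≠ 0) :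
    gaussianReal a v = (gaussianReal b v).withDensity
      (fun x => ENNReal.ofReal (Real.exp (((x - b) ^ 2 - (x - a) ^ 2) / (2 * v)))) := by
  rw [gaussianReal_of_var_ne_zero _ hv, gaussianReal_of_var_ne_zero _ hv,
    ← withDensity_mul _ (by fun_prop) (by fun_prop)]
  congr 1
  ext x
  simp only [Pi.mul_apply, gaussianPDF]
  rw [← ENNReal.ofReal_mul (gaussianPDFReal_nonneg _ _ _)]
  congr 1
  simp only [gaussianPDFReal]
  rw [mul_assoc (√(2 * Real.pi * (v : ℝ)))⁻¹, ← Real.exp_add]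
  congr 2
  ring

lemma gm_pi_density {k : ℕ} (a b : Fin k → ℝ) {v : NNReal} (hv : v ≠ 0) :
    Measure.pi (fun j => gaussianReal (a j) v) =
      (Measure.pi (fun j => gaussianReal (b j) v)).withDensity
      (fun x => ENNReal.ofReal
        (Real.exp ((∑ j, ((x j - b j) ^ 2 - (x j - a j) ^ 2)) / (2 * v)))) := by
  refine Measure.pi_eq fun s hs => ?_
  rw [withDensity_apply _ (MeasurableSet.univ_pi hs)]
  rw [← lintegral_indicator (MeasurableSet.univ_pi hs)]
  let X : Fin k → ℝ → ENNReal := fun j => (s j).indicator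
    (fun x => ENNReal.ofReal (Real.exp (((x - b j) ^ 2 - (x - a j) ^ 2) / (2 * v))))
  have hX : ∀ j, Measurable (X j) := fun j => Measurable.indicator (by fun_prop) (hs j)
  have hi : iIndepFun (fun j (x : Fin k → ℝ) => X j (x j))
      (Measure.pi (fun j => gaussianReal (b j) v)) :=
    iIndepFun_pi (fun j => (hX j).aemeasurable)
  have h1 := lintegral_prod_eq_prod_lintegral_of_indepFun Finset.univ _ hi
    (fun j => (hX j).comp (measurable_pi_apply j))
  have h2 : ∀ j, ∫⁻ x : Fin k → ℝ, X j (x j) ∂(Measure.pi (fun j => gaussianReal (b j) v))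
      = gaussianReal (a j) v (s j) := by
    intro j
    have := (measurePreserving_eval (fun j => gaussianReal (b j) v) j).lintegral_comp (hX j)
    simp only [Function.eval] at this
    rw [this, gm_density (a j) (b j) hv, withDensity_apply _ (hs j),
      ← lintegral_indicator (hs j)]
  simp_rw [h2] at h1
  rw [← h1]
  refine lintegral_congr fun x => ?_
  by_cases hx : x ∈ Set.univ.pi s
  · rw [Set.indicator_of_mem hx]
    have : ∀ j, X j (x j) =
        ENNReal.ofReal (Real.exp (((x j - b j) ^ 2 - (x j - a j) ^ 2) / (2 * v))) :=
      fun j => Set.indicator_of_mem (hx j (Set.mem_univ j)) _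
    simp_rw [this]
    rw [← ENNReal.ofReal_prod_of_nonneg (fun _ _ => (Real.exp_pos _).le), ← Real.exp_sum,
      Finset.sum_div]
  · rw [Set.indicator_of_notMem hx]
    simp only [Set.mem_univ_pi, not_forall] at hx
    obtain ⟨j, hj⟩ := hx
    exact (Finset.prod_eq_zero (Finset.mem_univ j) (Set.indicator_of_notMem hj _)).symm

lemma gm_le {k : ℕ} (a b : Fin k → ℝ) {v : NNReal} (hv : v ≠ 0) (c : ℝ)
    (T : Set (Fin k → ℝ)) (hT : MeasurableSet T)
    (h : ∀ x ∈ T, (∑ j, ((x j - b j) ^ 2 - (x j - a j) ^ 2)) / (2 * v) ≤ c) :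
    Measure.pi (fun j => gaussianReal (a j) v) T ≤
      ENNReal.ofReal (Real.exp c) * Measure.pi (fun j => gaussianReal (b j) v) T := by
  rw [gm_pi_density a b hv, withDensity_apply _ hT, ← setLIntegral_const]
  exact setLIntegral_mono measurable_const
    (fun x hx => ENNReal.ofReal_le_ofReal (Real.exp_le_exp.mpr (h x hx)))

lemma gm_half {k : ℕ} (m a : Fin k → ℝ) (v : NNReal) :
    Measure.pi (fun j => gaussianReal (m j) v) {x | 0 < ∑ j, (x j - m j) * a j} ≤
      ENNReal.ofReal (1 / 2) := by
  set μ := Measure.pi (fun j => gaussianReal (m j) v) with hμ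
  set H : Set (Fin k → ℝ) := {x | 0 < ∑ j, (x j - m j) * a j} with hH
  have hHm : MeasurableSet H := measurableSet_lt measurable_const (by fun_prop)
  have hmap : μ.map (fun x j => 2 * m j - x j) = μ := by
    have := Measure.pi_map_pi (μ := fun j => gaussianReal (m j) v)
      (f := fun j x => 2 * m j - x)
      (hμ := fun j => by rw [gaussianReal_map_const_sub]; infer_instance)
      (fun j => by fun_prop)
    rw [hμ, this]
    congr 1
    ext1 j
    rw [gaussianReal_map_const_sub]
    congr 1
    ring
  have h1 : μ H = μ {x | ∑ j, (x j - m j) * a j < 0} := by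
    conv_lhs => rw [← hmap]
    rw [Measure.map_apply (by fun_prop) hHm]
    congr 1
    ext x
    simp only [hH, Set.mem_preimage, Set.mem_ofPred_eq]
    have : ∑ j, (2 * m j - x j - m j) * a j = - ∑ j, (x j - m j) * a j := by
      rw [← Finset.sum_neg_distrib]
      exact Finset.sum_congr rfl fun j _ => by ring
    rw [this, neg_pos]
  have h2 : μ H + μ H ≤ 1 := by
    nth_rewrite 2 [h1]
    rw [← measure_union _ (measurableSet_lt (by fun_prop) measurable_const)]
    · exact prob_le_one
    · rw [Set.disjoint_left]
      intro x hx hx'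
      exact lt_asymm (show 0 < ∑ j, (x j - m j) * a j from hx) hx'
  rw [← ENNReal.ofReal_toReal (measure_ne_top μ H)]
  apply ENNReal.ofReal_le_ofReal
  have h3 := ENNReal.toReal_mono ENNReal.one_ne_top h2
  rw [ENNReal.toReal_add (measure_ne_top _ _) (measure_ne_top _ _)] at h3
  simp at h3
  linarith

lemma gm_tail {k : ℕ} (m a : Fin k → ℝ) {v : NNReal} (hv : v ≠ 0) (c : ℝ) (hc : 0 ≤ c)
    (ha : 0 < ∑ j, a j ^ 2) :
    Measure.pi (fun j => gaussianReal (m j) v) {x | c < ∑ j, (x j - m j) * a j} ≤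
      ENNReal.ofReal (Real.exp (-(c ^ 2 / (2 * v * ∑ j, a j ^ 2))) * (1 / 2)) := by
  set A := ∑ j, a j ^ 2 with hA
  have hv' : (0 : ℝ) < v := by exact_mod_cast pos_iff_ne_zero.mpr hv
  have hHm : MeasurableSet {x : Fin k → ℝ | 0 < ∑ j, (x j - m j) * a j} :=
    measurableSet_lt measurable_const (by fun_prop)
  have hmap : (Measure.pi (fun j => gaussianReal (m j) v)).map (fun x j => x j - c / A * a j)
      = Measure.pi (fun j => gaussianReal (m j - c / A * a j) v) := by
    have := Measure.pi_map_pi (μ := fun j => gaussianReal (m j) v)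
      (f := fun j x => x - c / A * a j)
      (hμ := fun j => by rw [gaussianReal_map_sub_const]; infer_instance)
      (fun j => by fun_prop)
    rw [this]
    congr 1
    ext1 j
    rw [gaussianReal_map_sub_const]
  have h1 : Measure.pi (fun j => gaussianReal (m j) v) {x | c < ∑ j, (x j - m j) * a j}
      = Measure.pi (fun j => gaussianReal (m j - c / A * a j) v)
        {x | 0 < ∑ j, (x j - m j) * a j} := by
    rw [← hmap, Measure.map_apply (by fun_prop) hHm]
    congr 1
    ext x
    simp only [Set.mem_preimage, Set.mem_ofPred_eq]
    have : ∑ j, (x j - c / A * a j - m j) * a j = ∑ j, (x j - m j) * a j - c := by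
      have : ∀ j, (x j - c / A * a j - m j) * a j = (x j - m j) * a j - c / A * a j ^ 2 :=
        fun j => by ring
      simp_rw [this]
      rw [Finset.sum_sub_distrib, ← Finset.mul_sum, ← hA, div_mul_cancel₀ _ ha.ne']
    rw [this, sub_pos]
  rw [h1, ENNReal.ofReal_mul (Real.exp_pos _).le]
  refine (gm_le _ m hv (-(c ^ 2 / (2 * v * A))) _ hHm ?_).trans
    (mul_le_mul_right (gm_half m a v) _)
  intro x hx
  have : ∑ j, ((x j - m j) ^ 2 - (x j - (m j - c / A * a j)) ^ 2)
      = -(2 * (c / A)) * ∑ j, (x j - m j) * a j - (c / A) ^ 2 * A := by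
    rw [hA, Finset.mul_sum, Finset.mul_sum, ← Finset.sum_sub_distrib]
    exact Finset.sum_congr rfl fun j _ => by ring
  rw [this]
  have hx' : 0 < ∑ j, (x j - m j) * a j := hx
  have e : -(c ^ 2 / (2 * v * A)) = (- ((c / A) ^ 2 * A)) / (2 * v) := by
    field_simp
  rw [e]
  apply div_le_div_of_nonneg_right _ (by positivity)
  have : 0 ≤ 2 * (c / A) * ∑ j, (x j - m j) * a j := by positivity
  linarith



lemma gm_main (k : ℕ) (hk : 1 ≤ k) (ε δ w σ : ℝ)
    (hε : 0 < ε) (hδ0 : 0 < δ) (hδ : δ < 1 / 2) (hw : 0 ≤ w)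
    (hσ : w * Real.sqrt (2 * (Real.log (1 / (2 * δ)) + ε)) / ε ≤ σ)
    (m m' : EuclideanSpace ℝ (Fin k)) (hmm' : ‖m - m'‖ ≤ w)
    (S : Set (Fin k → ℝ)) (hS : MeasurableSet S)
    (v : NNReal) (hvv : (v : ℝ) = σ ^ 2) :
    Measure.pi (fun j => gaussianReal (m j) v) S ≤
      ENNReal.ofReal (Real.exp ε) *
        Measure.pi (fun j => gaussianReal (m' j) v) S +
        ENNReal.ofReal δ := by
  by_cases hA0 : m = m'
  · subst hA0
    refine le_trans ?_ le_self_add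
    refine le_mul_of_one_le_left zero_le ?_
    rw [← ENNReal.ofReal_one]
    exact ENNReal.ofReal_le_ofReal (Real.one_le_exp hε.le)
  have hd : 0 < ‖m - m'‖ := norm_pos_iff.mpr (sub_ne_zero.mpr hA0)
  have hA : ‖m - m'‖ ^ 2 = ∑ j, (m j - m' j) ^ 2 := by
    rw [EuclideanSpace.norm_sq_eq]
    simp
  have hwp : 0 < w := hd.trans_le hmm'
  set L := Real.log (1 / (2 * δ)) with hL
  have hLpos : 0 < L := Real.log_pos (by rw [lt_div_iff₀ (by linarith)]; linarith)
  set A := ∑ j, (m j - m' j) ^ 2 with hAdef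
  have hApos : 0 < A := by rw [← hA]; positivity
  have hAw : A ≤ w ^ 2 := by rw [← hA]; gcongr
  have hσpos : 0 < σ := lt_of_lt_of_le (by positivity) hσ
  have hkey : A * (2 * (L + ε)) ≤ σ ^ 2 * ε ^ 2 := by
    rw [div_le_iff₀ hε] at hσ
    have h2 := pow_le_pow_left₀ (by positivity) hσ 2
    rw [mul_pow, mul_pow, Real.sq_sqrt (by positivity)] at h2
    exact (mul_le_mul_of_nonneg_right hAw (by positivity)).trans h2
  have hv : v ≠ 0 := by
    intro h
    rw [h] at hvv
    simp only [NNReal.coe_zero] at hvv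
    exact (pow_pos hσpos 2).ne hvv
  have hvpos : (0 : ℝ) < v := by rw [hvv]; positivity
  rw [← hvv] at hkey
  set c : ℝ := v * ε - A / 2 with hc
  have hcpos : 0 ≤ c := by
    have : A * (2 * ε) ≤ v * ε ^ 2 := le_trans (by nlinarith) hkey
    have : 2 * A ≤ v * ε := by
      by_contra! h
      nlinarith
    linarith
  set T : Set (Fin k → ℝ) := {x | c < ∑ j, (x j - m j) * (m j - m' j)} with hT
  have hTm : MeasurableSet T := measurableSet_lt measurable_const (by fun_prop)
  have htail : Measure.pi (fun j => gaussianReal (m j) v) T ≤ ENNReal.ofReal δ := by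
    refine (gm_tail (fun j => m j) (fun j => m j - m' j) hv c hcpos hApos).trans ?_
    apply ENNReal.ofReal_le_ofReal
    have h1 : L ≤ c ^ 2 / (2 * v * A) := by
      rw [le_div_iff₀ (by positivity), hc]
      have h3 := mul_le_mul_of_nonneg_left hkey hvpos.le
      have h4 : 0 ≤ v * A * ε := by positivity
      nlinarith [sq_nonneg A]
    have h2 : Real.exp (-(c ^ 2 / (2 * v * A))) ≤ 2 * δ := by
      calc _ ≤ Real.exp (-L) := Real.exp_le_exp.mpr (by linarith)
        _ = 2 * δ := by
          rw [hL, one_div, Real.log_inv, neg_neg, Real.exp_log (by linarith)]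
    linarith
  calc Measure.pi (fun j => gaussianReal (m j) v) S
      ≤ Measure.pi (fun j => gaussianReal (m j) v) (S \ T ∪ T) :=
        measure_mono (by rw [Set.sdiff_union_self]; exact Set.subset_union_left)
    _ ≤ _ := measure_union_le _ _
    _ ≤ _ := by
      refine add_le_add ?_ htail
      refine (gm_le (fun j => m j) (fun j => m' j) hv ε _ (hS.diff hTm) ?_).trans
        (mul_le_mul_right (measure_mono Set.sdiff_subset) _)
      intro x hx
      have hx2 : ∑ j, (x j - m j) * (m j - m' j) ≤ c := not_lt.mp hx.2
      have : ∑ j, ((x j - m' j) ^ 2 - (x j - m j) ^ 2)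
          = 2 * ∑ j, (x j - m j) * (m j - m' j) + A := by
        rw [hAdef, Finset.mul_sum, ← Finset.sum_add_distrib]
        exact Finset.sum_congr rfl fun j _ => by ring
      rw [this, div_le_iff₀ (by positivity)]
      linarith

/-- Gaussian mechanism for random projections (Theorem 4): if
`σ ≥ w √(2(ln(1/(2δ)) + ε)) / ε` and `‖m - m'‖₂ ≤ w`, then the product Gaussian
measures centered at `m` and `m'` with coordinate variance `σ²` satisfy the
`(ε, δ)`-differential privacy inequality on every measurable set. -/
theorem gaussian_mechanism_dp (k : ℕ) (hk : 1 ≤ k) (ε δ w σ : ℝ)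
    (hε : 0 < ε) (hδ0 : 0 < δ) (hδ : δ < 1 / 2) (hw : 0 ≤ w)
    (hσ : w * Real.sqrt (2 * (Real.log (1 / (2 * δ)) + ε)) / ε ≤ σ)
    (m m' : EuclideanSpace ℝ (Fin k)) (hmm' : ‖m - m'‖ ≤ w)
    (S : Set (Fin k → ℝ)) (hS : MeasurableSet S) :
    Measure.pi (fun j => gaussianReal (m j) ⟨σ ^ 2, sq_nonneg σ⟩) S ≤
      ENNReal.ofReal (Real.exp ε) *
        Measure.pi (fun j => gaussianReal (m' j) ⟨σ ^ 2, sq_nonneg σ⟩) S +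
        ENNReal.ofReal δ := by
  exact gm_main k hk ε δ w σ hε hδ0 hδ hw hσ m m' hmm' S hS ⟨σ ^ 2, sq_nonneg σ⟩ rfl
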